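/- Let 0 < α < β and M ≥ 0. For each L > 0 let a_L : [0,L] → ℝ be measurable with |a_L(x)| ≤ M for almost every x, let ψ_{k,L}(x) = √(2/L)·sin(kπx/L), and let N(L) = #{k ≥ 1 : α ≤ (kπ/L)² ≤ β}. Then (1/N(L)) · Σ_{k ≥ 1, α ≤ (kπ/L)² ≤ β} (∫_0^L a_L(x)·ψ_{k,L}(x)² dx − (1/L)∫_0^L a_L(x) dx)² → 0 as L → ∞ (the average being taken over all L large enough that N(L) ≥ 1). -/

import Mathlib

open MeasureTheory

/-- **Bessel's inequality** for real functions that are pairwise orthogonal with common squared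
norm `c`. -/
lemma sum_sq_integral_mul_le {Ω ι : Type*} [MeasurableSpace Ω] [DecidableEq ι] {μ : Measure Ω}
    {f : Ω → ℝ} {e : ι → Ω → ℝ} {c : ℝ} (S : Finset ι) (hf : MemLp f 2 μ)
    (he : ∀ i ∈ S, MemLp (e i) 2 μ) (hc : 0 < c)
    (horth : ∀ i ∈ S, ∀ j ∈ S, ∫ x, e i x * e j x ∂μ = if i = j then c else 0) :
    ∑ i ∈ S, (∫ x, f x * e i x ∂μ) ^ 2 ≤ c * ∫ x, f x ^ 2 ∂μ := by
  set b : ι → ℝ := fun i => ∫ x, f x * e i x ∂μ with hb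
  set g : Ω → ℝ := fun x => ∑ i ∈ S, b i * e i x with hg
  have hgm : MemLp g 2 μ := memLp_finsetSum S fun i hi => (he i hi).const_mul (b i)
  have hfg : ∫ x, f x * g x ∂μ = ∑ i ∈ S, b i ^ 2 := by
    have h : ∀ x, f x * g x = ∑ i ∈ S, b i * (f x * e i x) := fun x => by
      simp only [hg, Finset.mul_sum]
      exact Finset.sum_congr rfl fun i _ => by ring
    simp_rw [h]
    have hint : ∀ i ∈ S, Integrable (fun x => b i * (f x * e i x)) μ :=
      fun i hi => (hf.integrable_mul (he i hi)).const_mul (b i)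
    rw [integral_finsetSum S hint]
    refine Finset.sum_congr rfl fun i _ => ?_
    rw [integral_const_mul, sq]
  have heg : ∀ i ∈ S, ∫ x, e i x * g x ∂μ = c * b i := fun i hi => by
    have h : ∀ x, e i x * g x = ∑ j ∈ S, b j * (e i x * e j x) := fun x => by
      simp only [hg, Finset.mul_sum]
      exact Finset.sum_congr rfl fun i _ => by ring
    simp_rw [h]
    have hint : ∀ j ∈ S, Integrable (fun x => b j * (e i x * e j x)) μ :=
      fun j hj => ((he i hi).integrable_mul (he j hj)).const_mul (b j)
    rw [integral_finsetSum S hint]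
    simp_rw [integral_const_mul]
    rw [Finset.sum_congr rfl fun j hj => by rw [horth i hi j hj]]
    simp [hi, mul_comm]
  have hgg : ∫ x, g x * g x ∂μ = c * ∑ i ∈ S, b i ^ 2 := by
    have h : ∀ x, g x * g x = ∑ i ∈ S, b i * (e i x * g x) := fun x => by
      conv_lhs => rw [hg]
      simp only [Finset.sum_mul, mul_assoc]
      rfl
    simp_rw [h]
    have hint : ∀ i ∈ S, Integrable (fun x => b i * (e i x * g x)) μ :=
      fun i hi => ((he i hi).integrable_mul hgm).const_mul (b i)
    rw [integral_finsetSum S hint, Finset.mul_sum]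
    refine Finset.sum_congr rfl fun i hi => ?_
    rw [integral_const_mul, heg i hi]
    ring
  have hsq : ∫ x, (c * f x - g x) ^ 2 ∂μ
      = c ^ 2 * (∫ x, f x ^ 2 ∂μ) - 2 * c * (∫ x, f x * g x ∂μ) + ∫ x, g x * g x ∂μ := by
    have h : ∀ x, (c * f x - g x) ^ 2 = c ^ 2 * f x ^ 2 - 2 * c * (f x * g x) + g x * g x :=
      fun x => by ring
    have h1 : Integrable (fun x => c ^ 2 * f x ^ 2) μ := hf.integrable_sq.const_mul _
    have h2 : Integrable (fun x => 2 * c * (f x * g x)) μ := (hf.integrable_mul hgm).const_mul _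
    have h3 : Integrable (fun x => g x * g x) μ := hgm.integrable_mul hgm
    have h12 : Integrable (fun x => c ^ 2 * f x ^ 2 - 2 * c * (f x * g x)) μ := h1.sub h2
    simp_rw [h]
    rw [integral_add h12 h3, integral_sub h1 h2, integral_const_mul, integral_const_mul]
  have hnn : 0 ≤ ∫ x, (c * f x - g x) ^ 2 ∂μ := integral_nonneg fun x => sq_nonneg _
  rw [hsq, hfg, hgg] at hnn
  have : 0 ≤ c * (c * (∫ x, f x ^ 2 ∂μ) - ∑ i ∈ S, b i ^ 2) := by linarith
  linarith [nonneg_of_mul_nonneg_right this hc]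

lemma integral_cos_int_mul_two_pi_div {L : ℝ} (hL : 0 < L) {m : ℤ} (hm : m ≠ 0) :
    ∫ x in (0:ℝ)..L, Real.cos (2 * m * Real.pi / L * x) = 0 := by
  have hm' : (m : ℝ) ≠ 0 := by exact_mod_cast hm
  have hc : 2 * m * Real.pi / L ≠ 0 := by positivity
  rw [intervalIntegral.integral_comp_mul_left (fun x => Real.cos x) hc, integral_cos]
  have : 2 * m * Real.pi / L * L = ((2 * m : ℤ) : ℝ) * Real.pi := by
    push_cast
    field_simp
  rw [this, Real.sin_int_mul_pi]
  simp

lemma integral_cos_mul_cos_two_pi_div {L : ℝ} (hL : 0 < L) {i j : ℕ} (hi : 1 ≤ i) :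
    ∫ x in (0:ℝ)..L, Real.cos (2 * i * Real.pi / L * x) * Real.cos (2 * j * Real.pi / L * x)
      = if i = j then L / 2 else 0 := by
  have h : ∀ x : ℝ, Real.cos (2 * i * Real.pi / L * x) * Real.cos (2 * j * Real.pi / L * x)
      = 1 / 2 * (Real.cos (2 * ((i - j : ℤ) : ℝ) * Real.pi / L * x)
        + Real.cos (2 * ((i + j : ℤ) : ℝ) * Real.pi / L * x)) := fun x => by
    have h1 : 2 * ((i - j : ℤ) : ℝ) * Real.pi / L * x
        = 2 * i * Real.pi / L * x - 2 * j * Real.pi / L * x := by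
      push_cast
      ring
    have h2 : 2 * ((i + j : ℤ) : ℝ) * Real.pi / L * x
        = 2 * i * Real.pi / L * x + 2 * j * Real.pi / L * x := by
      push_cast
      ring
    rw [h1, h2, Real.cos_sub, Real.cos_add]
    ring
  have hint : ∀ m : ℤ, IntervalIntegrable (fun x => Real.cos (2 * m * Real.pi / L * x))
      volume 0 L := fun m => Continuous.intervalIntegrable (by fun_prop) _ _
  simp_rw [h]
  rw [intervalIntegral.integral_const_mul, intervalIntegral.integral_add (hint _) (hint _),
    integral_cos_int_mul_two_pi_div hL (m := i + j) (by omega)]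
  split_ifs with hij
  · subst hij
    simp
    ring
  · rw [integral_cos_int_mul_two_pi_div hL (m := i - j) (by omega)]
    simp

/-- The deviation of a Dirichlet eigenfunction's matrix element from the mean is a cosine
coefficient. -/
lemma integral_mul_sin_sq_sub_mean {L : ℝ} (hL : 0 < L) {f : ℝ → ℝ}
    (hf : IntervalIntegrable f volume 0 L) (k : ℕ) :
    (∫ x in (0:ℝ)..L, f x * (√(2 / L) * Real.sin (k * Real.pi * x / L)) ^ 2)
        - (1 / L) * ∫ x in (0:ℝ)..L, f x
      = -(1 / L) * ∫ x in (0:ℝ)..L, f x * Real.cos (2 * k * Real.pi / L * x) := by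
  have h : ∀ x, f x * (√(2 / L) * Real.sin (k * Real.pi * x / L)) ^ 2
      = (1 / L) * f x - (1 / L) * (f x * Real.cos (2 * k * Real.pi / L * x)) := fun x => by
    have h2 : 2 * k * Real.pi / L * x = 2 * (k * Real.pi * x / L) := by ring
    rw [h2, Real.cos_two_mul, mul_pow, Real.sq_sqrt (by positivity), Real.cos_sq']
    ring
  simp_rw [h]
  rw [intervalIntegral.integral_sub (hf.const_mul _)
      ((hf.mul_continuousOn (by fun_prop)).const_mul _),
    intervalIntegral.integral_const_mul, intervalIntegral.integral_const_mul]
  ring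

/-- The total variance over any finite set of modes is at most `M ^ 2 / 2`. -/
lemma sum_sq_integral_mul_sin_sq_sub_mean_le {L M : ℝ} (hL : 0 < L) {f : ℝ → ℝ}
    (hf : Measurable f) (hbd : ∀ᵐ x ∂(volume.restrict (Set.Icc (0:ℝ) L)), |f x| ≤ M)
    (S : Finset ℕ) (hS : ∀ k ∈ S, 1 ≤ k) :
    ∑ k ∈ S, ((∫ x in (0:ℝ)..L, f x * (√(2 / L) * Real.sin (k * Real.pi * x / L)) ^ 2)
        - (1 / L) * ∫ x in (0:ℝ)..L, f x) ^ 2 ≤ M ^ 2 / 2 := by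
  have hbd' : ∀ᵐ x ∂(volume.restrict (Set.Ioc (0:ℝ) L)), |f x| ≤ M :=
    ae_restrict_of_ae_restrict_of_subset Set.Ioc_subset_Icc_self hbd
  have hfL : MemLp f 2 (volume.restrict (Set.Ioc (0:ℝ) L)) :=
    MemLp.of_bound hf.aestronglyMeasurable M hbd'
  have hfi : IntervalIntegrable f volume 0 L := by
    rw [intervalIntegrable_iff_integrableOn_Ioc_of_le hL.le]
    exact hfL.integrable (by norm_num)
  have he : ∀ k ∈ S, MemLp (fun x => Real.cos (2 * k * Real.pi / L * x)) 2
      (volume.restrict (Set.Ioc (0:ℝ) L)) := fun k _ =>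
    MemLp.of_bound (by fun_prop) 1 (ae_of_all _ fun x => Real.abs_cos_le_one _)
  have hbessel := sum_sq_integral_mul_le S hfL he (half_pos hL) fun i hi j _ => by
    rw [← intervalIntegral.integral_of_le hL.le]
    exact integral_cos_mul_cos_two_pi_div hL (hS i hi)
  have hsq : ∫ x in Set.Ioc (0:ℝ) L, f x ^ 2 ≤ L * M ^ 2 := by
    calc ∫ x in Set.Ioc (0:ℝ) L, f x ^ 2 ≤ ∫ x in Set.Ioc (0:ℝ) L, M ^ 2 := by
          refine integral_mono_ae hfL.integrable_sq (integrable_const _) ?_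
          filter_upwards [hbd'] with x hx
          exact sq_le_sq' (abs_le.mp hx).1 (abs_le.mp hx).2
      _ = L * M ^ 2 := by simp [hL.le]
  simp_rw [integral_mul_sin_sq_sub_mean hL hfi, mul_pow, ← Finset.mul_sum]
  simp_rw [intervalIntegral.integral_of_le hL.le]
  calc (-(1 / L)) ^ 2 * _ ≤ (-(1 / L)) ^ 2 * (L / 2 * (L * M ^ 2)) := by
        gcongr
        exact hbessel.trans (by gcongr)
    _ = M ^ 2 / 2 := by field_simp

lemma spectral_window_eq_coe_Icc {α β L : ℝ} (hα : 0 < α) (hβ : 0 ≤ β) (hL : 0 < L) :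
    {k : ℕ | 1 ≤ k ∧ α ≤ ((k : ℝ) * Real.pi / L) ^ 2 ∧ ((k : ℝ) * Real.pi / L) ^ 2 ≤ β}
      = ↑(Finset.Icc ⌈√α * L / Real.pi⌉₊ ⌊√β * L / Real.pi⌋₊) := by
  ext k
  have hnn : 0 ≤ (k : ℝ) * Real.pi / L := by positivity
  have hpi := Real.pi_pos
  rw [Finset.coe_Icc, Set.mem_Icc, Nat.ceil_le, Nat.le_floor_iff (by positivity), Set.mem_ofPred_eq,
    ← Real.sqrt_le_left hnn, ← Real.le_sqrt hnn hβ, le_div_iff₀ hL, div_le_iff₀ hpi,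
    div_le_iff₀ hL, le_div_iff₀ hpi, and_iff_right_iff_imp]
  rintro ⟨h, -⟩
  have : 0 < (k : ℝ) * Real.pi := lt_of_lt_of_le (by positivity) h
  exact_mod_cast pos_of_mul_pos_left this hpi.le

lemma tendsto_ncard_spectral_window {α β : ℝ} (hα : 0 < α) (hαβ : α < β) :
    Filter.Tendsto (fun L : ℝ => (({k : ℕ | 1 ≤ k ∧ α ≤ ((k : ℝ) * Real.pi / L) ^ 2 ∧
      ((k : ℝ) * Real.pi / L) ^ 2 ≤ β}).ncard : ℝ)) Filter.atTop Filter.atTop := by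
  have hs : 0 < (√β - √α) / Real.pi :=
    div_pos (sub_pos.mpr (Real.sqrt_lt_sqrt hα.le hαβ)) Real.pi_pos
  refine Filter.tendsto_atTop_mono' _ ?_
    (Filter.tendsto_atTop_add_const_right _ (-1) (Filter.tendsto_id.const_mul_atTop hs))
  filter_upwards [Filter.eventually_gt_atTop 0] with L hL
  rw [spectral_window_eq_coe_Icc hα (hα.trans hαβ).le hL, Set.ncard_coe_finset, Nat.card_Icc]
  have h1 := Nat.lt_floor_add_one (√β * L / Real.pi)
  have h2 := Nat.ceil_lt_add_one (a := √α * L / Real.pi) (by positivity)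
  have h3 : ((⌊√β * L / Real.pi⌋₊ + 1 : ℕ) : ℝ) - (⌈√α * L / Real.pi⌉₊ : ℝ)
      ≤ ((⌊√β * L / Real.pi⌋₊ + 1 - ⌈√α * L / Real.pi⌉₊ : ℕ) : ℝ) := by
    rw [sub_le_iff_le_add]
    exact_mod_cast le_tsub_add
  push_cast at h3
  have h4 : (√β - √α) / Real.pi * id L = √β * L / Real.pi - √α * L / Real.pi := by
    simp only [id]
    ring
  rw [h4]
  linarith



/-- One-dimensional quantum ergodicity in the large-length limit with a fixed spectral
    window: the quantum variance over the window [α, β] tends to 0 as L → ∞. -/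
theorem stmt_8 (α β M : ℝ) (hα : 0 < α) (hαβ : α < β) (hM : 0 ≤ M)
    (a : ℝ → ℝ → ℝ)
    (hmeas : ∀ L : ℝ, 0 < L → Measurable (a L))
    (hbd : ∀ L : ℝ, 0 < L →
      ∀ᵐ x ∂(volume.restrict (Set.Icc (0:ℝ) L)), |a L x| ≤ M) :
    Filter.Tendsto (fun L : ℝ =>
        (1 / (({k : ℕ | 1 ≤ k ∧ α ≤ ((k : ℝ) * Real.pi / L) ^ 2 ∧
            ((k : ℝ) * Real.pi / L) ^ 2 ≤ β}).ncard : ℝ)) *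
          ∑ᶠ k ∈ {k : ℕ | 1 ≤ k ∧ α ≤ ((k : ℝ) * Real.pi / L) ^ 2 ∧
              ((k : ℝ) * Real.pi / L) ^ 2 ≤ β},
            ((∫ x in (0:ℝ)..L,
                a L x * (Real.sqrt (2 / L) * Real.sin ((k : ℝ) * Real.pi * x / L)) ^ 2)
              - (1 / L) * ∫ x in (0:ℝ)..L, a L x) ^ 2)
      Filter.atTop (nhds 0) := by
  have hlim : Filter.Tendsto (fun L : ℝ =>
      (1 / (({k : ℕ | 1 ≤ k ∧ α ≤ ((k : ℝ) * Real.pi / L) ^ 2 ∧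
        ((k : ℝ) * Real.pi / L) ^ 2 ≤ β}).ncard : ℝ)) * (M ^ 2 / 2)) Filter.atTop (nhds 0) := by
    simpa using (tendsto_ncard_spectral_window hα hαβ).inv_tendsto_atTop.mul_const (M ^ 2 / 2)
  refine squeeze_zero' (Filter.Eventually.of_forall fun L => ?_) ?_ hlim
  · exact mul_nonneg (by positivity)
      (finsum_nonneg fun k => finsum_nonneg fun _ => sq_nonneg _)
  · filter_upwards [Filter.eventually_gt_atTop 0] with L hL
    refine mul_le_mul_of_nonneg_left ?_ (by positivity)
    have hwin := spectral_window_eq_coe_Icc hα (hα.trans hαβ).le hL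
    refine (finsum_mem_congr hwin fun k _ => rfl).trans_le ?_
    rw [finsum_mem_coe_finset]
    refine sum_sq_integral_mul_sin_sq_sub_mean_le hL (hmeas L hL) (hbd L hL) _ fun k hk => ?_
    rw [← Finset.mem_coe, ← hwin] at hk
    exact hk.1
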